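/- arXiv:1403.6747 — 5 statements merged into one kernel-verified Lean document; each statement's English description precedes it below -/
import Mathlib

section
/- Let k be a field, F = k((u))((t)), and let φ, f ∈ k((u)) ⊆ F. Let m ≥ 1 and l ≤ −1 be integers. Then: (i) the residue of f·t^l · d(1+φt^m)/(1+φt^m) ∧ dt/t, namely c_{−1,−1}( f·∂_u φ · t^{m+l−1} · (1+φt^m)^{−1} ), equals 0 if m+l > 0, and equals the coefficient of u^{−1} in f·∂_u φ if m+l = 0; (ii) the residue of f·t^l · d(1+φt^m)/(1+φt^m) ∧ du/u, namely c_{−1,−1}( −m·f·φ·u^{−1}·t^{m+l−1}·(1+φt^m)^{−1} ), equals 0 if m+l > 0, and equals −m·(coefficient of u^0 in f·φ) if m+l = 0, where the integer −m acts on k via the natural ring map ℤ → k. -/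
/-- Formal derivative on Laurent series: `(lsDeriv f).coeff n = (n+1) • f.coeff (n+1)`. -/
noncomputable def lsDeriv {R : Type*} [AddCommGroup R] (f : LaurentSeries R) : LaurentSeries R :=
  HahnSeries.ofSuppBddBelow (fun n => (n + 1) • f.coeff (n + 1))
    (HahnSeries.forallLTEqZero_supp_BddBelow _ (f.order - 1)
      (fun _ hm => by rw [HahnSeries.coeff_eq_zero_of_lt_order (by omega), smul_zero]))

/-- The inverse of `1 + φ t ^ m` in `K((t))` is a power series with constant term `1`. -/
theorem exists_powerSeries_inv_one_add {K : Type*} [Field K] (φ : K) {m : ℕ} (hm : 1 ≤ m) :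
    ∃ P : PowerSeries K, PowerSeries.constantCoeff P = 1 ∧
      (1 + HahnSeries.C φ * HahnSeries.single (m : ℤ) (1 : K))⁻¹ =
        HahnSeries.ofPowerSeries ℤ K P := by
  have hQ : PowerSeries.constantCoeff (1 + PowerSeries.C φ * PowerSeries.X ^ m) = 1 := by
    simp [zero_pow (show m ≠ 0 by omega)]
  refine ⟨(1 + PowerSeries.C φ * PowerSeries.X ^ m)⁻¹, ?_, inv_eq_of_mul_eq_one_right ?_⟩
  · rw [PowerSeries.constantCoeff_inv, hQ, inv_one]
  · have h : HahnSeries.ofPowerSeries ℤ K (1 + PowerSeries.C φ * PowerSeries.X ^ m) =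
        1 + HahnSeries.C φ * HahnSeries.single (m : ℤ) (1 : K) := by
      simp [HahnSeries.ofPowerSeries_X_pow]
    rw [← h, ← map_mul, PowerSeries.mul_inv_cancel _ (by rw [hQ]; exact one_ne_zero), map_one]

/-- The `t⁻¹`-coefficient of `g t ^ (n - 1) (1 + φ t ^ m)⁻¹` for `n ≥ 0`. -/
theorem coeff_neg_one_mul_inv_one_add {K : Type*} [Field K] (g φ : K) {m : ℕ} (hm : 1 ≤ m)
    {n : ℤ} (hn : 0 ≤ n) :
    (HahnSeries.C g * HahnSeries.single (n - 1) (1 : K) *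
      (1 + HahnSeries.C φ * HahnSeries.single (m : ℤ) (1 : K))⁻¹).coeff (-1) =
        if n = 0 then g else 0 := by
  obtain ⟨P, hP, hinv⟩ := exists_powerSeries_inv_one_add φ hm
  have hshift : (-1 : ℤ) = -n + (n - 1) := by ring
  rw [hinv, mul_assoc, HahnSeries.C_mul_eq_smul, HahnSeries.coeff_smul, hshift,
    HahnSeries.coeff_single_mul_add, one_mul]
  split_ifs with h
  · subst h
    have h0 := HahnSeries.ofPowerSeries_apply_coeff (Γ := ℤ) P 0
    rw [Nat.cast_zero, PowerSeries.coeff_zero_eq_constantCoeff_apply, hP] at h0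
    rw [neg_zero, h0, smul_eq_mul, mul_one]
  · have h0 : (HahnSeries.ofPowerSeries ℤ K P).coeff (-n) = 0 := by
      rw [HahnSeries.ofPowerSeries_apply]
      refine HahnSeries.embDomain_of_notMem_range ?_
      rintro ⟨a, ha⟩
      change (a : ℤ) = -n at ha
      omega
    rw [h0, smul_zero]

/-- residue computations in `F = k((u))((t))` for the forms
`f t^l · d(1+φt^m)/(1+φt^m) ∧ dt/t` and `f t^l · d(1+φt^m)/(1+φt^m) ∧ du/u`, where
`φ, f ∈ k((u))`.  The first is represented by `f · ∂_u φ · t^{m+l-1} · (1+φt^m)⁻¹` and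
the second by `-m · f · φ · u⁻¹ · t^{m+l-1} · (1+φt^m)⁻¹`, and `c_{-1,-1}` of each is
computed according to the sign of `m + l`. -/
theorem residue_computation_fixed_curve
    (k : Type*) [Field k]
    (φ f : LaurentSeries k) (m : ℕ) (hm : 1 ≤ m) (l : ℤ) (hl : l ≤ -1) :
    ((0 < (m : ℤ) + l →
        (((HahnSeries.C f * HahnSeries.C (lsDeriv φ) *
            HahnSeries.single ((m : ℤ) + l - 1) (1 : LaurentSeries k) *
            (1 + HahnSeries.C φ * HahnSeries.single (m : ℤ) (1 : LaurentSeries k))⁻¹ :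
              LaurentSeries (LaurentSeries k)).coeff (-1)).coeff (-1)) = 0) ∧
      ((m : ℤ) + l = 0 →
        (((HahnSeries.C f * HahnSeries.C (lsDeriv φ) *
            HahnSeries.single ((m : ℤ) + l - 1) (1 : LaurentSeries k) *
            (1 + HahnSeries.C φ * HahnSeries.single (m : ℤ) (1 : LaurentSeries k))⁻¹ :
              LaurentSeries (LaurentSeries k)).coeff (-1)).coeff (-1))
          = (f * lsDeriv φ).coeff (-1))) ∧
    ((0 < (m : ℤ) + l →
        (((-(m : LaurentSeries (LaurentSeries k)) * HahnSeries.C f * HahnSeries.C φ *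
            HahnSeries.C (HahnSeries.single (-1 : ℤ) (1 : k)) *
            HahnSeries.single ((m : ℤ) + l - 1) (1 : LaurentSeries k) *
            (1 + HahnSeries.C φ * HahnSeries.single (m : ℤ) (1 : LaurentSeries k))⁻¹ :
              LaurentSeries (LaurentSeries k)).coeff (-1)).coeff (-1)) = 0) ∧
      ((m : ℤ) + l = 0 →
        (((-(m : LaurentSeries (LaurentSeries k)) * HahnSeries.C f * HahnSeries.C φ *
            HahnSeries.C (HahnSeries.single (-1 : ℤ) (1 : k)) *
            HahnSeries.single ((m : ℤ) + l - 1) (1 : LaurentSeries k) *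
            (1 + HahnSeries.C φ * HahnSeries.single (m : ℤ) (1 : LaurentSeries k))⁻¹ :
              LaurentSeries (LaurentSeries k)).coeff (-1)).coeff (-1))
          = -((m : k) * (f * φ).coeff 0))) := by
  have hcast : -(m : LaurentSeries (LaurentSeries k)) =
      HahnSeries.C (-(m : LaurentSeries k)) := by
    rw [map_neg, map_natCast]
  have hm0 : (-(m : LaurentSeries k) * f * φ * HahnSeries.single (-1 : ℤ) (1 : k)).coeff (-1) =
      -((m : k) * (f * φ).coeff 0) := by
    have hmC : (m : LaurentSeries k) = HahnSeries.C (m : k) := (map_natCast _ m).symm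
    have hshift := HahnSeries.coeff_mul_single_add (r := (1 : k))
      (x := -(m : LaurentSeries k) * f * φ) (a := (0 : ℤ)) (b := -1)
    rw [zero_add] at hshift
    rw [hshift, mul_one, mul_assoc, neg_mul, HahnSeries.coeff_neg, hmC, HahnSeries.C_mul_eq_smul, HahnSeries.coeff_smul,
      smul_eq_mul]
  simp only [hcast, ← map_mul]
  refine ⟨⟨fun h => ?_, fun h => ?_⟩, fun h => ?_, fun h => ?_⟩
  · rw [coeff_neg_one_mul_inv_one_add _ _ hm h.le, if_neg h.ne', HahnSeries.coeff_zero]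
  · rw [coeff_neg_one_mul_inv_one_add _ _ hm h.ge, if_pos h]
  · rw [coeff_neg_one_mul_inv_one_add _ _ hm h.le, if_neg h.ne', HahnSeries.coeff_zero]
  · rw [coeff_neg_one_mul_inv_one_add _ _ hm h.ge, if_pos h, hm0]
end

section
/- Let k be a field of characteristic p > 0 and let F₁ = k((u))((t)) and F₂ = k((t))((u)); the monomials u^a t^b and constants from k are regarded as elements of both fields. For α, β ∈ F₁^× and h ∈ F₁ set (α,β|h]₁ := c_{−1,−1}( h·(α^{−1}∂_u α·β^{−1}∂_t β − α^{−1}∂_t α·β^{−1}∂_u β) ), and for α, β ∈ F₂^× and h ∈ F₂ set (α,β|h]₂ := c'_{−1,−1}( h·(α^{−1}∂_t α·β^{−1}∂_u β − α^{−1}∂_u α·β^{−1}∂_t β) ). Let i, j ≥ 1 be integers with p ∤ i and p ∣ j, let a, b, c ∈ k, let k₀, l₀ ∈ ℤ, and put z = c·u^{k₀}t^{l₀}. Then (1+a·u^i t^j, t | z]₁ + (1+b·u^i t^j, t | z]₂ equals i·c·(a−b) if k₀ = −i and l₀ = −j, and equals 0 if i+k₀ > 0 and j+l₀ > 0. Symmetrically,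 if p ∣ i and p ∤ j and a', b' ∈ k, then (1+a'·u^i t^j, u | z]₁ + (1+b'·u^i t^j, u | z]₂ equals j·c·(b'−a') if k₀ = −i and l₀ = −j, and equals 0 if i+k₀ > 0 and j+l₀ > 0. (Integers act on k via the natural ring map ℤ → k.) -/
theorem lsDeriv_zero {R : Type*} [AddCommGroup R] : lsDeriv (0 : LaurentSeries R) = 0 := by
  ext n; simp [lsDeriv]

/-- The formal partial derivative with respect to the inner variable of an iterated
Laurent series field, acting coefficientwise. -/
noncomputable def llDerivInner {k : Type*} [AddCommGroup k]
    (f : LaurentSeries (LaurentSeries k)) : LaurentSeries (LaurentSeries k) where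
  coeff := fun b => lsDeriv (f.coeff b)
  isPWO_support' := f.isPWO_support.mono (fun b hb => by
    simp only [Function.mem_support] at hb ⊢
    exact fun h0 => hb (by rw [h0, lsDeriv_zero]))

/-- The length-one Witt (residue) pairing of a two-dimensional local field of iterated
Laurent series, with respect to (inner, outer) local parameters:
`(α,β|h] = c_{-1,-1}(h·(α⁻¹·∂_in α·β⁻¹·∂_out β − α⁻¹·∂_out α·β⁻¹·∂_in β))`.
For `F₁ = k((u))((t))` (inner `u`, outer `t`) this is `( , | ]₁`; for
`F₂ = k((t))((u))` (inner `t`, outer `u`) this is `( , | ]₂`, whose sign reflects the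
ordering `dt ∧ du`. -/
noncomputable def wittPair {k : Type*} [Field k]
    (α β h : LaurentSeries (LaurentSeries k)) : k :=
  ((h * (α⁻¹ * llDerivInner α * (β⁻¹ * lsDeriv β) -
      α⁻¹ * lsDeriv α * (β⁻¹ * llDerivInner β))).coeff (-1)).coeff (-1)

open HahnSeries in
theorem lsDeriv_single {R : Type*} [AddCommGroup R] (n : ℤ) (a : R) :
    lsDeriv (single n a) = single (n - 1) (n • a) := by
  ext m
  by_cases h : m = n - 1
  · subst h
    simp [lsDeriv]
  · simp [lsDeriv, coeff_single_of_ne h, coeff_single_of_ne (show m + 1 ≠ n by omega)]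

theorem lsDeriv_add {R : Type*} [AddCommGroup R] (f g : LaurentSeries R) :
    lsDeriv (f + g) = lsDeriv f + lsDeriv g := by
  ext m
  simp [lsDeriv]

theorem lsDeriv_one {R : Type*} [Ring R] : lsDeriv (1 : LaurentSeries R) = 0 := by
  rw [← HahnSeries.single_zero_one, lsDeriv_single]
  simp

open HahnSeries in
theorem llDerivInner_single {k : Type*} [AddCommGroup k] (m : ℤ) (x : LaurentSeries k) :
    llDerivInner (single m x) = single m (lsDeriv x) := by
  ext1
  funext q
  by_cases h : q = m
  · subst h
    simp [llDerivInner]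
  · simp [llDerivInner, coeff_single_of_ne h, lsDeriv_zero]

theorem llDerivInner_add {k : Type*} [AddCommGroup k] (f g : LaurentSeries (LaurentSeries k)) :
    llDerivInner (f + g) = llDerivInner f + llDerivInner g := by
  ext1
  funext q
  simp [llDerivInner, lsDeriv_add]

theorem llDerivInner_one {k : Type*} [Ring k] :
    llDerivInner (1 : LaurentSeries (LaurentSeries k)) = 0 := by
  rw [← HahnSeries.single_zero_one, llDerivInner_single, lsDeriv_one]
  simp

section OneAddSingle

variable {K : Type*} [Field K] {m : ℤ} (hm : 0 < m) (x : K)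
include hm

open HahnSeries in
theorem coeff_zero_one_add_single : (1 + single m x : LaurentSeries K).coeff 0 = 1 := by
  simp [coeff_single_of_ne hm.ne]

open HahnSeries in
theorem coeff_inv_one_add_single_of_neg {q : ℤ} (hq : q < 0) :
    ((1 + single m x : LaurentSeries K)⁻¹).coeff q = 0 := by
  have h0 := coeff_zero_one_add_single hm x
  set α : LaurentSeries K := 1 + single m x
  have hα : α ≠ 0 := fun h => by simp [h] at h0
  have hle : α.order ≤ 0 := order_le_of_coeff_ne_zero (by simp [h0])
  have hord := order_mul hα (inv_ne_zero hα)
  rw [mul_inv_cancel₀ hα, order_one] at hord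
  exact coeff_eq_zero_of_lt_order (by omega)

open HahnSeries in
theorem coeff_zero_inv_one_add_single :
    ((1 + single m x : LaurentSeries K)⁻¹).coeff 0 = 1 := by
  have h0 := coeff_zero_one_add_single hm x
  have hneg := coeff_inv_one_add_single_of_neg hm x (q := -m) (by omega)
  have hα : (1 + single m x : LaurentSeries K) ≠ 0 := fun h => by simp [h] at h0
  have h := congrArg (fun f : LaurentSeries K => f.coeff 0) (mul_inv_cancel₀ hα)
  rw [add_mul, one_mul] at h
  have hs := coeff_single_mul (r := x) (x := (1 + single m x : LaurentSeries K)⁻¹) (a := 0) (b := m)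
  simpa [hs, hneg] using h

end OneAddSingle

section WittPair

variable {k : Type*} [Field k] (m n l r : ℤ) (a c : k)

open HahnSeries

theorem zsmul_single : m • (single n a : LaurentSeries k) = single n (m * a) := by
  ext q
  rw [coeff_smul]
  by_cases h : q = n
  · subst h
    simp
  · simp [coeff_single_of_ne h]

theorem lsDeriv_one_add_single : lsDeriv (1 + single m (single n a)) =
    (single (m - 1) (single n (m * a)) : LaurentSeries (LaurentSeries k)) := by
  rw [lsDeriv_add, lsDeriv_one, lsDeriv_single, zsmul_single, zero_add]

theorem llDerivInner_one_add_single : llDerivInner (1 + single m (single n a)) =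
    (single m (single (n - 1) (n * a)) : LaurentSeries (LaurentSeries k)) := by
  rw [llDerivInner_add, llDerivInner_one, llDerivInner_single, lsDeriv_single, zero_add,
    zsmul_eq_mul]

theorem inv_mul_lsDeriv_outer :
    (single 1 1 : LaurentSeries (LaurentSeries k))⁻¹ * lsDeriv (single 1 1) = single (-1) 1 := by
  simp [lsDeriv_single]

theorem inv_mul_llDerivInner_outer :
    (single 1 1 : LaurentSeries (LaurentSeries k))⁻¹ * llDerivInner (single 1 1) = 0 := by
  simp [llDerivInner_single, lsDeriv_one]

theorem inv_mul_lsDeriv_inner :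
    (single 0 (single 1 1) : LaurentSeries (LaurentSeries k))⁻¹ * lsDeriv (single 0 (single 1 1)) =
      0 := by
  rw [lsDeriv_single, zero_smul, map_zero, mul_zero]

theorem inv_mul_llDerivInner_inner :
    (single 0 (single 1 1) : LaurentSeries (LaurentSeries k))⁻¹ *
      llDerivInner (single 0 (single 1 1)) = single 0 (single (-1) 1) := by
  rw [llDerivInner_single, lsDeriv_single, inv_single, inv_single, single_mul_single,
    single_mul_single]
  simp

theorem wittPair_one_add_single_outer :
    wittPair (1 + single m (single n a)) (single 1 1) (single l (single r c)) =
      n * a * c *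
        ((1 + single m (single n a) : LaurentSeries (LaurentSeries k))⁻¹.coeff (-l - m)).coeff
          (-r - n) := by
  have e : (single (l + m - 1) (single (r + n - 1) (n * a * c)) :
      LaurentSeries (LaurentSeries k)) =
        single l (single r c) * single m (single (n - 1) (n * a)) * single (-1) 1 := by
    simp only [single_mul_single, mul_one]
    ring_nf
  rw [wittPair, inv_mul_lsDeriv_outer, inv_mul_llDerivInner_outer, llDerivInner_one_add_single,
    mul_zero, sub_zero]
  generalize (1 + single m (single n a) : LaurentSeries (LaurentSeries k))⁻¹ = y
  rw [show single l (single r c) * (y * single m (single (n - 1) (n * a)) * single (-1) 1) =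
    single (l + m - 1) (single (r + n - 1) (n * a * c)) * y by rw [e]; ring,
    coeff_single_mul, coeff_single_mul]
  ring_nf

theorem wittPair_one_add_single_inner :
    wittPair (1 + single m (single n a)) (single 0 (single 1 1)) (single l (single r c)) =
      -(m * a * c *
        ((1 + single m (single n a) : LaurentSeries (LaurentSeries k))⁻¹.coeff (-l - m)).coeff
          (-r - n)) := by
  have e : (single (l + m - 1) (single (r + n - 1) (m * a * c)) :
      LaurentSeries (LaurentSeries k)) =
        single l (single r c) * single (m - 1) (single n (m * a)) * single 0 (single (-1) 1) := by
    simp only [single_mul_single, mul_one]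
    ring_nf
  rw [wittPair, inv_mul_lsDeriv_inner, inv_mul_llDerivInner_inner, lsDeriv_one_add_single,
    mul_zero, zero_sub]
  generalize (1 + single m (single n a) : LaurentSeries (LaurentSeries k))⁻¹ = y
  rw [show single l (single r c) *
      -(y * single (m - 1) (single n (m * a)) * single 0 (single (-1) 1)) =
    -(single (l + m - 1) (single (r + n - 1) (m * a * c)) * y) by rw [e]; ring,
    coeff_neg, coeff_neg, coeff_single_mul, coeff_single_mul]
  ring_nf

variable {m n l r}

theorem wittPair_one_add_single_outer_of_pos (hm : 0 < m) (h : 0 < m + l) :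
    wittPair (1 + single m (single n a)) (single 1 1) (single l (single r c)) = 0 := by
  rw [wittPair_one_add_single_outer, coeff_inv_one_add_single_of_neg hm _ (by omega)]
  simp

theorem wittPair_one_add_single_inner_of_pos (hm : 0 < m) (h : 0 < m + l) :
    wittPair (1 + single m (single n a)) (single 0 (single 1 1)) (single l (single r c)) = 0 := by
  rw [wittPair_one_add_single_inner, coeff_inv_one_add_single_of_neg hm _ (by omega)]
  simp

theorem wittPair_one_add_single_outer_of_eq_neg (hm : 0 < m) :
    wittPair (1 + single m (single n a)) (single 1 1) (single (-m) (single (-n) c)) =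
      n * a * c := by
  simp [wittPair_one_add_single_outer, coeff_zero_inv_one_add_single hm]

theorem wittPair_one_add_single_inner_of_eq_neg (hm : 0 < m) :
    wittPair (1 + single m (single n a)) (single 0 (single 1 1)) (single (-m) (single (-n) c)) =
      -(m * a * c) := by
  simp [wittPair_one_add_single_inner, coeff_zero_inv_one_add_single hm]

end WittPair

/-- the two local Witt pairings at a normal crossing point, summed over the
two two-dimensional local fields `F₁ = k((u))((t))` and `F₂ = k((t))((u))`, evaluated on
`({1+a·u^i t^j, t}, z)` resp. `({1+a'·u^i t^j, u}, z)` with `z = c·u^{k₀} t^{l₀}`,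
in the cases `p ∤ i, p ∣ j` resp. `p ∣ i, p ∤ j`.  In `F₁` the element `u^{k₀}t^{l₀}` is
`HahnSeries.single l₀ (HahnSeries.single k₀ 1)`, in `F₂` it is
`HahnSeries.single k₀ (HahnSeries.single l₀ 1)`. -/
theorem witt_pairing_point_case_one
    (p : ℕ) (hp : p.Prime) (k : Type*) [Field k] [CharP k p]
    (i j : ℕ) (hi : 1 ≤ i) (hj : 1 ≤ j)
    (c : k) (k₀ l₀ : ℤ) :
    ((¬ p ∣ i → p ∣ j → ∀ a b : k,
        ((k₀ = -(i : ℤ) ∧ l₀ = -(j : ℤ)) →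
          wittPair (1 + HahnSeries.single (j : ℤ) (HahnSeries.single (i : ℤ) a))
              (HahnSeries.single (1 : ℤ) (1 : LaurentSeries k))
              (HahnSeries.single l₀ (HahnSeries.single k₀ c)) +
            wittPair (1 + HahnSeries.single (i : ℤ) (HahnSeries.single (j : ℤ) b))
              (HahnSeries.single (0 : ℤ) (HahnSeries.single (1 : ℤ) (1 : k)))
              (HahnSeries.single k₀ (HahnSeries.single l₀ c))
            = (i : k) * c * (a - b)) ∧
        ((0 < (i : ℤ) + k₀ ∧ 0 < (j : ℤ) + l₀) →
          wittPair (1 + HahnSeries.single (j : ℤ) (HahnSeries.single (i : ℤ) a))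
              (HahnSeries.single (1 : ℤ) (1 : LaurentSeries k))
              (HahnSeries.single l₀ (HahnSeries.single k₀ c)) +
            wittPair (1 + HahnSeries.single (i : ℤ) (HahnSeries.single (j : ℤ) b))
              (HahnSeries.single (0 : ℤ) (HahnSeries.single (1 : ℤ) (1 : k)))
              (HahnSeries.single k₀ (HahnSeries.single l₀ c))
            = 0))) ∧
    (p ∣ i → ¬ p ∣ j → ∀ a' b' : k,
        ((k₀ = -(i : ℤ) ∧ l₀ = -(j : ℤ)) →
          wittPair (1 + HahnSeries.single (j : ℤ) (HahnSeries.single (i : ℤ) a'))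
              (HahnSeries.single (0 : ℤ) (HahnSeries.single (1 : ℤ) (1 : k)))
              (HahnSeries.single l₀ (HahnSeries.single k₀ c)) +
            wittPair (1 + HahnSeries.single (i : ℤ) (HahnSeries.single (j : ℤ) b'))
              (HahnSeries.single (1 : ℤ) (1 : LaurentSeries k))
              (HahnSeries.single k₀ (HahnSeries.single l₀ c))
            = (j : k) * c * (b' - a')) ∧
        ((0 < (i : ℤ) + k₀ ∧ 0 < (j : ℤ) + l₀) →
          wittPair (1 + HahnSeries.single (j : ℤ) (HahnSeries.single (i : ℤ) a'))
              (HahnSeries.single (0 : ℤ) (HahnSeries.single (1 : ℤ) (1 : k)))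
              (HahnSeries.single l₀ (HahnSeries.single k₀ c)) +
            wittPair (1 + HahnSeries.single (i : ℤ) (HahnSeries.single (j : ℤ) b'))
              (HahnSeries.single (1 : ℤ) (1 : LaurentSeries k))
              (HahnSeries.single k₀ (HahnSeries.single l₀ c))
            = 0)) := by
  have hi' : (0 : ℤ) < i := by omega
  have hj' : (0 : ℤ) < j := by omega
  refine ⟨fun _ _ a b => ⟨?_, ?_⟩, fun _ _ a b => ⟨?_, ?_⟩⟩
  · rintro ⟨rfl, rfl⟩
    rw [wittPair_one_add_single_outer_of_eq_neg _ _ hj',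
      wittPair_one_add_single_inner_of_eq_neg _ _ hi']
    push_cast
    ring
  · rintro ⟨h₁, h₂⟩
    rw [wittPair_one_add_single_outer_of_pos _ _ hj' h₂,
      wittPair_one_add_single_inner_of_pos _ _ hi' h₁, add_zero]
  · rintro ⟨rfl, rfl⟩
    rw [wittPair_one_add_single_inner_of_eq_neg _ _ hj',
      wittPair_one_add_single_outer_of_eq_neg _ _ hi']
    push_cast
    ring
  · rintro ⟨h₁, h₂⟩
    rw [wittPair_one_add_single_inner_of_pos _ _ hj' h₂,
      wittPair_one_add_single_outer_of_pos _ _ hi' h₁, add_zero]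
end

section
/- Let k be a field and F = k((u))((t)). Let x ∈ F^× be a unit of the ring of integers of the t-adic valuation, i.e. c_{a,b}(x) = 0 for all b < 0 and the t^0-coefficient x̄ ∈ k((u)) of x is nonzero. Then the two-dimensional residue of dx/x ∧ dt/t equals the one-dimensional residue of dx̄/x̄; explicitly, c_{−1,−1}( x^{−1}·∂_u x · t^{−1} ) equals the coefficient of u^{−1} in x̄^{−1}·∂_u x̄ (computed in k((u))). -/
/-- The partial derivative `∂_u` on `k((u))((t))`, acting coefficientwise (in `t`) by the
formal derivative in the inner variable `u`. -/
noncomputable def llDerivU {k : Type*} [AddCommGroup k]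
    (f : LaurentSeries (LaurentSeries k)) : LaurentSeries (LaurentSeries k) where
  coeff := fun b => lsDeriv (f.coeff b)
  isPWO_support' := f.isPWO_support.mono (fun b hb => by
    simp only [Function.mem_support] at hb ⊢
    exact fun h0 => hb (by rw [h0, lsDeriv_zero]))

theorem HahnSeries.coeff_zero_mul_of_coeff_neg_eq_zero {Γ R : Type*} [AddCommGroup Γ]
    [LinearOrder Γ] [IsOrderedAddMonoid Γ] [NonUnitalNonAssocSemiring R] {f g : HahnSeries Γ R}
    (hf : ∀ b < 0, f.coeff b = 0) (hg : ∀ b < 0, g.coeff b = 0) :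
    (f * g).coeff 0 = f.coeff 0 * g.coeff 0 := by
  rw [HahnSeries.coeff_mul]
  refine Finset.sum_eq_single (0, 0) ?_ ?_
  · rintro ⟨a, b⟩ hab hne
    rw [Finset.mem_antidiagonal] at hab
    obtain ⟨ha, hb, hsum⟩ := hab
    have ha0 : 0 ≤ a := not_lt.1 fun h => ha (hf a h)
    have hb0 : 0 ≤ b := not_lt.1 fun h => hb (hg b h)
    obtain ⟨rfl, rfl⟩ := (add_eq_zero_iff_of_nonneg ha0 hb0).1 hsum
    exact absurd rfl hne
  · intro h
    by_contra hne
    exact h (Finset.mem_antidiagonal.2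
      ⟨left_ne_zero_of_mul hne, right_ne_zero_of_mul hne, add_zero 0⟩)

theorem HahnSeries.order_eq_zero_of_coeff_neg_eq_zero {Γ R : Type*} [AddCommGroup Γ]
    [LinearOrder Γ] [Zero R] {f : HahnSeries Γ R}
    (hf : ∀ b < 0, f.coeff b = 0) (h0 : f.coeff 0 ≠ 0) : f.order = 0 :=
  le_antisymm (HahnSeries.order_le_of_coeff_ne_zero h0) <| not_lt.1 fun h =>
    HahnSeries.coeff_order_eq_zero.not.2 (HahnSeries.ne_zero_of_coeff_ne_zero h0) (hf _ h)

theorem HahnSeries.coeff_inv_eq_zero_of_neg {Γ K : Type*} [AddCommGroup Γ]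
    [LinearOrder Γ] [IsOrderedAddMonoid Γ] [Field K] {f : HahnSeries Γ K}
    (hf : ∀ b < 0, f.coeff b = 0) (h0 : f.coeff 0 ≠ 0) {b : Γ} (hb : b < 0) :
    f⁻¹.coeff b = 0 := by
  have hne : f ≠ 0 := HahnSeries.ne_zero_of_coeff_ne_zero h0
  have h := HahnSeries.order_mul hne (inv_ne_zero hne)
  rw [mul_inv_cancel₀ hne, HahnSeries.order_one,
    HahnSeries.order_eq_zero_of_coeff_neg_eq_zero hf h0, zero_add] at h
  exact HahnSeries.coeff_eq_zero_of_lt_order (h ▸ hb)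

theorem HahnSeries.coeff_zero_inv {Γ K : Type*} [AddCommGroup Γ]
    [LinearOrder Γ] [IsOrderedAddMonoid Γ] [Field K] {f : HahnSeries Γ K}
    (hf : ∀ b < 0, f.coeff b = 0) (h0 : f.coeff 0 ≠ 0) :
    f⁻¹.coeff 0 = (f.coeff 0)⁻¹ := by
  have hne : f ≠ 0 := HahnSeries.ne_zero_of_coeff_ne_zero h0
  refine eq_inv_of_mul_eq_one_right ?_
  rw [← HahnSeries.coeff_zero_mul_of_coeff_neg_eq_zero hf
      fun b hb => HahnSeries.coeff_inv_eq_zero_of_neg hf h0 hb,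
    mul_inv_cancel₀ hne, HahnSeries.coeff_one, if_pos rfl]

/-- for a `t`-adic unit `x ∈ k((u))((t))` (no negative `t`-coefficients,
nonzero `t⁰`-coefficient `x̄`), the two-dimensional residue of `dx/x ∧ dt/t`, i.e.
`c_{-1,-1}(x⁻¹ ∂_u x · t⁻¹)`, equals the one-dimensional residue of `dx̄/x̄`, i.e. the
coefficient of `u⁻¹` in `x̄⁻¹ ∂_u x̄`. -/
theorem residue_of_unit_wedge_dt_over_t
    (k : Type*) [Field k]
    (x : LaurentSeries (LaurentSeries k))
    (hneg : ∀ b : ℤ, b < 0 → x.coeff b = 0)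
    (h0 : x.coeff 0 ≠ 0) :
    ((x⁻¹ * llDerivU x * HahnSeries.single (-1 : ℤ) (1 : LaurentSeries k)).coeff
        (-1)).coeff (-1)
      = ((x.coeff 0)⁻¹ * lsDeriv (x.coeff 0)).coeff (-1) := by
  have hshift : ∀ f : LaurentSeries (LaurentSeries k),
      (f * HahnSeries.single (-1 : ℤ) (1 : LaurentSeries k)).coeff (-1) = f.coeff 0 := fun f => by
    simpa using HahnSeries.coeff_mul_single_add (r := (1 : LaurentSeries k)) (x := f)
      (a := (0 : ℤ)) (b := -1)
  have hderiv : ∀ b < 0, (llDerivU x).coeff b = 0 := fun b hb => by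
    simp only [llDerivU, hneg b hb, lsDeriv_zero]
  rw [hshift, HahnSeries.coeff_zero_mul_of_coeff_neg_eq_zero
      (fun b hb => HahnSeries.coeff_inv_eq_zero_of_neg hneg h0 hb) hderiv,
    HahnSeries.coeff_zero_inv hneg h0]
  rfl
end

section
/- Let k be a finite field with q elements of characteristic p, let F = k((u))((t)), let v ∈ k, and let i, j ≥ 1 be integers. In the Milnor K-group K₂(F), the element {1 − i·v·u^i t^j, u} − {1 + j·v·u^i t^j, t} lies in the subgroup generated by all symbols {x, α} with α ∈ F^× and x ∈ F^× such that every nonzero coefficient c_{a,b}(x − 1) has a ≥ 0, b ≥ 0 and a + b ≥ i + j + 1 (i.e. x ≡ 1 modulo the (i+j+1)-st power of the maximal ideal (u,t) of the subring of power series). Here i·v denotes the image of the integer i in k times v. -/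
open scoped TensorProduct Classical

/-- The Steinberg subgroup of `Fˣ ⊗_ℤ Fˣ` (written additively via `Additive`): the
subgroup generated by the elements `a ⊗ (1 - a)` for `a ∈ Fˣ`, `a ≠ 1`.  The quotient by
it is the Milnor K-group `K₂(F)`. -/
noncomputable def steinbergSubgroup (F : Type*) [Field F] :
    AddSubgroup (Additive Fˣ ⊗[ℤ] Additive Fˣ) :=
  AddSubgroup.closure
    {z | ∃ (a : Fˣ) (ha : (1 : F) - (a : F) ≠ 0),
      z = Additive.ofMul a ⊗ₜ[ℤ] Additive.ofMul (Units.mk0 ((1 : F) - (a : F)) ha)}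

/-- The Milnor `K₂`-symbol `{x, y}` in `K₂(F) = (Fˣ ⊗_ℤ Fˣ) / ⟨Steinberg relations⟩`,
written additively, with the junk value `0` if `x = 0` or `y = 0`. -/
noncomputable def milnorSymbol {F : Type*} [Field F] (x y : F) :
    (Additive Fˣ ⊗[ℤ] Additive Fˣ) ⧸ steinbergSubgroup F :=
  if hx : x = 0 then 0 else if hy : y = 0 then 0 else
    QuotientAddGroup.mk
      (Additive.ofMul (Units.mk0 x hx) ⊗ₜ[ℤ] Additive.ofMul (Units.mk0 y hy))

section MilnorSymbol

variable {F : Type*} [Field F]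

theorem milnorSymbol_of_ne_zero {x y : F} (hx : x ≠ 0) (hy : y ≠ 0) :
    milnorSymbol x y = QuotientAddGroup.mk
      (Additive.ofMul (Units.mk0 x hx) ⊗ₜ[ℤ] Additive.ofMul (Units.mk0 y hy)) := by
  simp [milnorSymbol, hx, hy]

theorem milnorSymbol_mul_left {x y z : F} (hx : x ≠ 0) (hy : y ≠ 0) :
    milnorSymbol (x * y) z = milnorSymbol x z + milnorSymbol y z := by
  by_cases hz : z = 0
  · simp [milnorSymbol, hz]
  · rw [milnorSymbol_of_ne_zero hx hz, milnorSymbol_of_ne_zero hy hz,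
      milnorSymbol_of_ne_zero (mul_ne_zero hx hy) hz, Units.mk0_mul, ofMul_mul,
      TensorProduct.add_tmul, QuotientAddGroup.mk_add]

theorem milnorSymbol_mul_right {x y z : F} (hy : y ≠ 0) (hz : z ≠ 0) :
    milnorSymbol x (y * z) = milnorSymbol x y + milnorSymbol x z := by
  by_cases hx : x = 0
  · simp [milnorSymbol, hx]
  · rw [milnorSymbol_of_ne_zero hx hy, milnorSymbol_of_ne_zero hx hz,
      milnorSymbol_of_ne_zero hx (mul_ne_zero hy hz), Units.mk0_mul, ofMul_mul,
      TensorProduct.tmul_add, QuotientAddGroup.mk_add]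

theorem milnorSymbol_one_left (z : F) : milnorSymbol 1 z = 0 := by
  have h := milnorSymbol_mul_left (z := z) (one_ne_zero (α := F)) one_ne_zero
  rwa [one_mul, left_eq_add] at h

theorem milnorSymbol_one_right (z : F) : milnorSymbol z 1 = 0 := by
  have h := milnorSymbol_mul_right (x := z) (one_ne_zero (α := F)) one_ne_zero
  rwa [one_mul, left_eq_add] at h

theorem milnorSymbol_pow_left {x : F} (hx : x ≠ 0) (z : F) (n : ℕ) :
    milnorSymbol (x ^ n) z = n • milnorSymbol x z := by
  induction n with
  | zero => simp [milnorSymbol_one_left]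
  | succ n ih => rw [pow_succ, milnorSymbol_mul_left (pow_ne_zero n hx) hx, ih, succ_nsmul]

theorem milnorSymbol_pow_right (z : F) {x : F} (hx : x ≠ 0) (n : ℕ) :
    milnorSymbol z (x ^ n) = n • milnorSymbol z x := by
  induction n with
  | zero => simp [milnorSymbol_one_right]
  | succ n ih => rw [pow_succ, milnorSymbol_mul_right (pow_ne_zero n hx) hx, ih, succ_nsmul]

theorem milnorSymbol_one_sub_left {x : F} (hx : x ≠ 0) (hx' : 1 - x ≠ 0) :
    milnorSymbol (1 - x) x = 0 := by
  rw [milnorSymbol_of_ne_zero hx' hx, QuotientAddGroup.eq_zero_iff]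
  refine AddSubgroup.subset_closure ⟨Units.mk0 (1 - x) hx', by simpa using hx, ?_⟩
  simp

/-- The subgroup of `K₂(F)` generated by the symbols `{x, α}` with `x ≠ 0` satisfying `P`. -/
noncomputable def symbolSubgroup (P : F → Prop) :
    AddSubgroup ((Additive Fˣ ⊗[ℤ] Additive Fˣ) ⧸ steinbergSubgroup F) :=
  AddSubgroup.closure
    {z | ∃ x α : F, x ≠ 0 ∧ α ≠ 0 ∧ P x ∧ z = milnorSymbol x α}

end MilnorSymbol

theorem sq_dvd_one_sub_pow_sub {R : Type*} [CommRing R] (z : R) (n : ℕ) :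
    z ^ 2 ∣ (1 - z) ^ n - (1 - n * z) := by
  induction n with
  | zero => simp
  | succ n ih =>
    obtain ⟨c, hc⟩ := ih
    refine ⟨c * (1 - z) + n, ?_⟩
    rw [pow_succ, eq_add_of_sub_eq hc]
    push_cast
    ring

section IteratedLaurent

variable {k : Type*} [Field k]

/-- The inclusion of `k⟦u⟧⟦t⟧` into `k((u))((t))`. -/
noncomputable def iteratedLaurentOfPowerSeries (k : Type*) [Field k] :
    PowerSeries (PowerSeries k) →+* LaurentSeries (LaurentSeries k) :=
  (HahnSeries.ofPowerSeries ℤ (LaurentSeries k)).comp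
    (PowerSeries.map (HahnSeries.ofPowerSeries ℤ k))

theorem HahnSeries.ofPowerSeries_monomial {R : Type*} [CommRing R] (n : ℕ) (r : R) :
    HahnSeries.ofPowerSeries ℤ R (PowerSeries.monomial n r) = HahnSeries.single (n : ℤ) r := by
  have h : PowerSeries.monomial n r = PowerSeries.C r * PowerSeries.X ^ n := by
    rw [PowerSeries.X_pow_eq, ← PowerSeries.monomial_zero_eq_C_apply,
      PowerSeries.monomial_mul_monomial, zero_add, mul_one]
  rw [h, map_mul, HahnSeries.ofPowerSeries_X_pow, HahnSeries.ofPowerSeries_C,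
    HahnSeries.C_apply, HahnSeries.single_mul_single, zero_add, mul_one]

theorem nonneg_of_coeff_ofPowerSeries_ne_zero {R : Type*} [CommRing R] {f : PowerSeries R}
    {a : ℤ} (h : (HahnSeries.ofPowerSeries ℤ R f).coeff a ≠ 0) : 0 ≤ a := by
  by_contra ha
  apply h
  rw [HahnSeries.ofPowerSeries_apply]
  apply HahnSeries.embDomain_of_notMem_range
  rintro ⟨n, rfl⟩
  exact ha (by simp)

theorem nonneg_of_coeff_iteratedLaurentOfPowerSeries_ne_zero {f : PowerSeries (PowerSeries k)}
    {a b : ℤ} (h : ((iteratedLaurentOfPowerSeries k f).coeff b).coeff a ≠ 0) :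
    0 ≤ a ∧ 0 ≤ b := by
  have hb : 0 ≤ b := by
    refine nonneg_of_coeff_ofPowerSeries_ne_zero
      (f := PowerSeries.map (HahnSeries.ofPowerSeries ℤ k) f) fun h0 => h ?_
    rw [iteratedLaurentOfPowerSeries, RingHom.comp_apply, h0, HahnSeries.coeff_zero]
  refine ⟨?_, hb⟩
  lift b to ℕ using hb
  rw [iteratedLaurentOfPowerSeries, RingHom.comp_apply,
    HahnSeries.ofPowerSeries_apply_coeff, PowerSeries.coeff_map] at h
  exact nonneg_of_coeff_ofPowerSeries_ne_zero h

theorem le_of_coeff_single_mul_iteratedLaurentOfPowerSeries_ne_zero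
    {f : PowerSeries (PowerSeries k)} {m n a b : ℤ}
    (h : ((HahnSeries.single n (HahnSeries.single m (1 : k)) *
      iteratedLaurentOfPowerSeries k f).coeff b).coeff a ≠ 0) : m ≤ a ∧ n ≤ b := by
  rw [HahnSeries.coeff_single_mul, HahnSeries.coeff_single_mul, one_mul] at h
  obtain ⟨ha, hb⟩ := nonneg_of_coeff_iteratedLaurentOfPowerSeries_ne_zero h
  exact ⟨sub_nonneg.mp ha, sub_nonneg.mp hb⟩

/-- The monomial `c u^i t^j` of `k⟦u⟧⟦t⟧`. -/
noncomputable def biMonomial (i j : ℕ) (c : k) : PowerSeries (PowerSeries k) :=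
  PowerSeries.monomial j (PowerSeries.monomial i c)

theorem iteratedLaurentOfPowerSeries_biMonomial (i j : ℕ) (c : k) :
    iteratedLaurentOfPowerSeries k (biMonomial i j c) =
      HahnSeries.single (j : ℤ) (HahnSeries.single (i : ℤ) c) := by
  have h : PowerSeries.map (HahnSeries.ofPowerSeries ℤ k) (biMonomial i j c) =
      PowerSeries.monomial j (HahnSeries.single (i : ℤ) c) := by
    ext n : 1
    rw [biMonomial, PowerSeries.coeff_map, PowerSeries.coeff_monomial,
      PowerSeries.coeff_monomial]
    split_ifs
    · exact HahnSeries.ofPowerSeries_monomial i c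
    · exact map_zero _
  rw [iteratedLaurentOfPowerSeries, RingHom.comp_apply, h, HahnSeries.ofPowerSeries_monomial]

theorem biMonomial_mul_biMonomial (i j i' j' : ℕ) (c c' : k) :
    biMonomial i j c * biMonomial i' j' c' = biMonomial (i + i') (j + j') (c * c') := by
  simp only [biMonomial, PowerSeries.monomial_mul_monomial]

theorem isUnit_of_biMonomial_dvd_sub_one {i j : ℕ} (hj : 1 ≤ j) {c : k}
    {x : PowerSeries (PowerSeries k)} (h : biMonomial i j c ∣ x - 1) : IsUnit x := by
  obtain ⟨d, hd⟩ := h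
  rw [PowerSeries.isUnit_iff_constantCoeff, eq_add_of_sub_eq hd, map_add, map_mul, biMonomial,
    ← PowerSeries.coeff_zero_eq_constantCoeff_apply, PowerSeries.coeff_monomial,
    if_neg (by omega)]
  simp

/-- The elements of `k((u))((t))` congruent to `1` modulo the `n`-th power of the maximal ideal
of `k⟦u,t⟧`. -/
def IsHigherUnit (n : ℤ) (x : LaurentSeries (LaurentSeries k)) : Prop :=
  ∀ a b : ℤ, ((x - 1).coeff b).coeff a ≠ 0 → 0 ≤ a ∧ 0 ≤ b ∧ n ≤ a + b

/-- Replacing the first entry by a unit congruent to it modulo `(u^m t^n)` changes a symbol by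
an element of `symbolSubgroup (IsHigherUnit N)`. -/
theorem milnorSymbol_sub_mem_symbolSubgroup {m n : ℕ} {N : ℤ} (hN : N ≤ m + n)
    {x y : PowerSeries (PowerSeries k)} (hx : IsUnit x) (hy : IsUnit y)
    (h : biMonomial m n 1 ∣ y - x) {α : LaurentSeries (LaurentSeries k)} (hα : α ≠ 0) :
    milnorSymbol (iteratedLaurentOfPowerSeries k y) α -
      milnorSymbol (iteratedLaurentOfPowerSeries k x) α ∈ symbolSubgroup (IsHigherUnit N) := by
  obtain ⟨x, rfl⟩ := hx
  obtain ⟨y, rfl⟩ := hy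
  obtain ⟨d, hd⟩ := h
  have hne (z : (PowerSeries (PowerSeries k))ˣ) :
      iteratedLaurentOfPowerSeries k z ≠ 0 := (z.isUnit.map _).ne_zero
  have hyx : (y : PowerSeries (PowerSeries k)) = x * ↑(x⁻¹ * y) := by simp
  rw [hyx, map_mul, milnorSymbol_mul_left (hne _) (hne _), add_sub_cancel_left]
  refine AddSubgroup.subset_closure ⟨_, α, hne _, hα, fun a b hab => ?_, rfl⟩
  have hquot : (↑(x⁻¹ * y) - 1 : PowerSeries (PowerSeries k)) =
      biMonomial m n 1 * (x⁻¹.val * d) := by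
    rw [mul_left_comm, ← hd, mul_sub]
    simp
  rw [← map_one (iteratedLaurentOfPowerSeries k), ← map_sub, hquot, map_mul,
    iteratedLaurentOfPowerSeries_biMonomial] at hab
  have := le_of_coeff_single_mul_iteratedLaurentOfPowerSeries_ne_zero hab
  omega

end IteratedLaurent

/-- in `K₂(F)` for `F = k((u))((t))` over a finite field `k` of
characteristic `p`, for `v ∈ k` and `i, j ≥ 1`, the element
`{1 - i·v·u^i t^j, u} - {1 + j·v·u^i t^j, t}` lies in the subgroup generated by the
symbols `{x, α}` with `α ∈ Fˣ` and `x ∈ Fˣ` congruent to `1` modulo the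
`(i+j+1)`-st power of the maximal ideal `(u,t)` of `k⟦u,t⟧`, i.e. every nonzero
coefficient `c_{a,b}(x-1)` has `a ≥ 0`, `b ≥ 0` and `a + b ≥ i + j + 1`. -/
theorem symbol_congruence_u_vs_t
    (p : ℕ) (hp : p.Prime) (k : Type*) [Field k] [Fintype k] [CharP k p]
    (v : k) (i j : ℕ) (hi : 1 ≤ i) (hj : 1 ≤ j) :
    milnorSymbol
        (1 - HahnSeries.single (j : ℤ) (HahnSeries.single (i : ℤ) ((i : k) * v))
          : LaurentSeries (LaurentSeries k))
        (HahnSeries.single (0 : ℤ) (HahnSeries.single (1 : ℤ) (1 : k))) -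
      milnorSymbol
        (1 + HahnSeries.single (j : ℤ) (HahnSeries.single (i : ℤ) ((j : k) * v)))
        (HahnSeries.single (1 : ℤ) (1 : LaurentSeries k))
      ∈ AddSubgroup.closure
        {z | ∃ x α : LaurentSeries (LaurentSeries k), x ≠ 0 ∧ α ≠ 0 ∧
          (∀ a b : ℤ, ((x - 1).coeff b).coeff a ≠ 0 →
            0 ≤ a ∧ 0 ≤ b ∧ (i : ℤ) + (j : ℤ) + 1 ≤ a + b) ∧
          z = milnorSymbol x α} := by
  change _ ∈ symbolSubgroup (IsHigherUnit ((i : ℤ) + j + 1))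
  rcases eq_or_ne v 0 with rfl | hv
  · simp [milnorSymbol_one_left]
  set φ := iteratedLaurentOfPowerSeries k
  set u : LaurentSeries (LaurentSeries k) := HahnSeries.single 0 (HahnSeries.single 1 1) with hu
  set t : LaurentSeries (LaurentSeries k) := HahnSeries.single 1 1 with ht
  set A := symbolSubgroup (IsHigherUnit (k := k) ((i : ℤ) + j + 1))
  set w := biMonomial i j v with hw
  set κ : LaurentSeries (LaurentSeries k) := HahnSeries.single 0 (HahnSeries.single 0 v) with hκ
  have hu0 : u ≠ 0 := by simp [hu]
  have ht0 : t ≠ 0 := by simp [ht]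
  have hκ0 : κ ≠ 0 := by simp [hκ, hv]
  have hφw : φ w = κ * u ^ i * t ^ j := by
    simp [φ, hw, hκ, hu, ht, iteratedLaurentOfPowerSeries_biMonomial]
  have hsingle (n : ℕ) : φ (n * w) =
      HahnSeries.single (j : ℤ) (HahnSeries.single (i : ℤ) ((n : k) * v)) := by
    rw [← iteratedLaurentOfPowerSeries_biMonomial]
    congr 1
    simp [hw, biMonomial, ← nsmul_eq_mul]
  have hunit {x : PowerSeries (PowerSeries k)} (h : w ∣ x - 1) : IsUnit x :=
    isUnit_of_biMonomial_dvd_sub_one hj h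
  have hmem {x y : PowerSeries (PowerSeries k)} (hx : IsUnit x) (hy : IsUnit y)
      (h : w ^ 2 ∣ y - x) {α : LaurentSeries (LaurentSeries k)} (hα : α ≠ 0) :
      milnorSymbol (φ y) α - milnorSymbol (φ x) α ∈ A := by
    refine milnorSymbol_sub_mem_symbolSubgroup (m := i * 2) (n := j * 2) (by push_cast; omega)
      hx hy (dvd_trans ⟨biMonomial 0 0 (v ^ 2), ?_⟩ h) hα
    rw [hw, pow_two, biMonomial_mul_biMonomial, biMonomial_mul_biMonomial, mul_two, mul_two,
      add_zero, add_zero, one_mul, pow_two]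
  have hs : IsUnit (1 - w) := hunit ⟨-1, by ring⟩
  have hs0 : φ (1 - w) ≠ 0 := (hs.map φ).ne_zero
  have hsu : milnorSymbol (φ (1 - i * w)) u - i • milnorSymbol (φ (1 - w)) u ∈ A := by
    rw [← milnorSymbol_pow_left hs0, ← map_pow]
    refine hmem (hs.pow i) (hunit ⟨-i, by ring⟩) ?_ hu0
    rw [dvd_sub_comm]
    exact sq_dvd_one_sub_pow_sub w i
  have hst : milnorSymbol (φ (1 + j * w)) t + j • milnorSymbol (φ (1 - w)) t ∈ A := by
    have hj' : IsUnit (1 + j * w) := hunit ⟨j, by ring⟩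
    rw [← milnorSymbol_pow_left hs0, ← map_pow,
      ← milnorSymbol_mul_left (hj'.map φ).ne_zero ((hs.pow j).map φ).ne_zero, ← map_mul]
    obtain ⟨c, hc⟩ := sq_dvd_one_sub_pow_sub w j
    have h := hmem isUnit_one (hj'.mul (hs.pow j))
      ⟨c * (1 + j * w) - j ^ 2, by rw [eq_add_of_sub_eq hc]; ring⟩ ht0
    rwa [map_one, milnorSymbol_one_left, sub_zero] at h
  have hsκ : milnorSymbol (φ (1 - w)) κ ∈ A := by
    have hκq : κ ^ Fintype.card k = κ := by
      simp [hκ, HahnSeries.single_pow, FiniteField.pow_card]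
    rw [← hκq, milnorSymbol_pow_right _ hκ0, ← milnorSymbol_pow_left hs0, ← map_pow]
    have h := hmem isUnit_one (hs.pow (Fintype.card k)) ?_ hκ0
    · rwa [map_one, milnorSymbol_one_left, sub_zero] at h
    obtain ⟨c, hc⟩ := sq_dvd_one_sub_pow_sub w (Fintype.card k)
    have hq : (Fintype.card k : PowerSeries (PowerSeries k)) = 0 := by
      rw [← map_natCast (algebraMap k (PowerSeries (PowerSeries k))), FiniteField.cast_card_eq_zero,
        map_zero]
    exact ⟨c, by simpa [hq] using hc⟩
  have hsteinberg : milnorSymbol (φ (1 - w)) κ + i • milnorSymbol (φ (1 - w)) u +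
      j • milnorSymbol (φ (1 - w)) t = 0 := by
    rw [← milnorSymbol_pow_right _ hu0, ← milnorSymbol_pow_right _ ht0,
      ← milnorSymbol_mul_right hκ0 (pow_ne_zero i hu0),
      ← milnorSymbol_mul_right (mul_ne_zero hκ0 (pow_ne_zero i hu0)) (pow_ne_zero j ht0), ← hφw,
      map_sub, map_one]
    rw [map_sub, map_one] at hs0
    refine milnorSymbol_one_sub_left ?_ hs0
    rw [hφw]
    exact mul_ne_zero (mul_ne_zero hκ0 (pow_ne_zero i hu0)) (pow_ne_zero j ht0)
  rw [← hsingle, ← hsingle, ← map_one φ, ← map_sub, ← map_add]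
  have h := A.sub_mem (A.sub_mem hsu hst) hsκ
  rw [← add_zero (_ - _), ← hsteinberg] at h
  convert h using 1
  abel
end

section
/- Let k be a field and F = k((u))((t)). Suppose h ∈ F^× is a principal unit, i.e. h ≠ 1 and the pair (v₂(h−1), v̄₁(h−1)) is lexicographically strictly greater than (0,0) (equivalently h − 1 lies in the maximal ideal of the rank-two valuation ring of F), or h = 1. Then for all f, g ∈ F^×, the higher tame symbol (f, g, h) equals 1; likewise (f, h, g) = 1 and (h, f, g) = 1. -/
/-- `v₂ f`: the `t`-adic order of `f ∈ k((u))((t))` (with `v₂ 0 = 0` as a junk value). -/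
noncomputable def v2 {k : Type*} [Field k] (f : LaurentSeries (LaurentSeries k)) : ℤ :=
  f.order

/-- `v̄₁ f`: the `u`-adic order of the leading `t`-coefficient of `f`. -/
noncomputable def v1 {k : Type*} [Field k] (f : LaurentSeries (LaurentSeries k)) : ℤ :=
  (f.coeff f.order).order

/-- The higher tame symbol of `f, g, h ∈ k((u))((t))ˣ`:
`(f,g,h) = c₀,₀((-1)^α · f^{v₂(g)v̄₁(h)-v₂(h)v̄₁(g)} · g^{-(v₂(f)v̄₁(h)-v₂(h)v̄₁(f))} ·
h^{v₂(f)v̄₁(g)-v₂(g)v̄₁(f)})`. -/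
noncomputable def tameSymbol {k : Type*} [Field k]
    (f g h : LaurentSeries (LaurentSeries k)) : k :=
  (((-1 : LaurentSeries (LaurentSeries k)) ^
        (v2 f * v2 g * v1 h + v2 f * v2 h * v1 g + v2 g * v2 h * v1 f +
          v2 f * v1 g * v1 h + v2 g * v1 f * v1 h + v2 h * v1 f * v1 g) *
      f ^ (v2 g * v1 h - v2 h * v1 g) *
      g ^ (-(v2 f * v1 h - v2 h * v1 f)) *
      h ^ (v2 f * v1 g - v2 g * v1 f)).coeff 0).coeff 0

namespace HahnSeries

theorem coeff_zero_eq_leadingCoeff {Γ R : Type*} [PartialOrder Γ] [Zero Γ] [Zero R]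
    {x : HahnSeries Γ R} (hx : x.order = 0) :
    x.coeff 0 = x.leadingCoeff := by
  rw [leadingCoeff_eq, hx]

variable {Γ R : Type*} [AddCommGroup Γ] [LinearOrder Γ] [IsOrderedAddMonoid Γ] [Field R]

theorem leadingCoeff_zpow (x : HahnSeries Γ R) (n : ℤ) :
    (x ^ n).leadingCoeff = x.leadingCoeff ^ n :=
  map_zpow₀ ({ toFun := leadingCoeff
               map_zero' := leadingCoeff_zero
               map_one' := leadingCoeff_one
               map_mul' := fun x y ↦ leadingCoeff_mul x y } : HahnSeries Γ R →*₀ R) x n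

theorem order_inv (x : HahnSeries Γ R) : x⁻¹.order = -x.order := by
  rcases eq_or_ne x 0 with rfl | hx
  · simp
  · have h := order_mul hx (inv_ne_zero hx)
    rw [mul_inv_cancel₀ hx, order_one] at h
    exact (neg_eq_of_add_eq_zero_right h.symm).symm

theorem order_zpow (x : HahnSeries Γ R) (n : ℤ) : (x ^ n).order = n • x.order := by
  cases n with
  | ofNat n => simp
  | negSucc n => rw [zpow_negSucc, order_inv, order_pow, negSucc_zsmul]

end HahnSeries

section PrincipalUnit

variable {k : Type*} [Field k] {h : LaurentSeries (LaurentSeries k)}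

theorem coeff_zero_sub_one_orderTop_pos (hh : h = 1 ∨ (h ≠ 1 ∧
      (0 < v2 (h - 1) ∨ (v2 (h - 1) = 0 ∧ 0 < v1 (h - 1))))) :
    0 < (h.coeff 0 - 1).orderTop := by
  have key : h.coeff 0 - 1 = (h - 1).coeff 0 := by simp
  rw [key]
  rcases hh with rfl | ⟨-, h2 | ⟨h2, h1⟩⟩
  · simp
  · rw [HahnSeries.coeff_eq_zero_of_lt_order h2]
    simp
  · unfold v1 at h1
    unfold v2 at h2
    rw [h2] at h1
    exact HahnSeries.zero_lt_orderTop_of_order h1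

theorem order_sub_one_nonneg (hh : h = 1 ∨ (h ≠ 1 ∧
      (0 < v2 (h - 1) ∨ (v2 (h - 1) = 0 ∧ 0 < v1 (h - 1))))) :
    0 ≤ (h - 1).order := by
  rcases hh with rfl | ⟨-, h2 | ⟨h2, -⟩⟩
  · simp
  · exact h2.le
  · exact h2.ge

theorem order_eq_zero_of_principal_unit (hh : h = 1 ∨ (h ≠ 1 ∧
      (0 < v2 (h - 1) ∨ (v2 (h - 1) = 0 ∧ 0 < v1 (h - 1))))) :
    h.order = 0 := by
  have hlc := ((HahnSeries.orderTop_self_sub_one_pos_iff _).1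
    (coeff_zero_sub_one_orderTop_pos hh)).2
  have h0 : h.coeff 0 ≠ 0 := fun h0 ↦ by simp [h0] at hlc
  refine le_antisymm (HahnSeries.order_le_of_coeff_ne_zero h0) ?_
  by_contra! hneg
  have hc : (h - 1).coeff h.order = 0 :=
    HahnSeries.coeff_eq_zero_of_lt_order (hneg.trans_le (order_sub_one_nonneg hh))
  rw [HahnSeries.coeff_sub, HahnSeries.coeff_one, if_neg hneg.ne, sub_zero] at hc
  exact HahnSeries.coeff_order_eq_zero.not.2 (fun h' ↦ h0 (by simp [h'])) hc

theorem coeff_coeff_zpow_eq_one (h2 : v2 h = 0) (h1 : v1 h = 0)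
    (hlc : h.leadingCoeff.leadingCoeff = 1) (n : ℤ) :
    ((h ^ n).coeff 0).coeff 0 = 1 := by
  have h1' : h.leadingCoeff.order = 0 := by rwa [HahnSeries.leadingCoeff_eq]
  have h2' : h.order = 0 := h2
  rw [HahnSeries.coeff_zero_eq_leadingCoeff (x := h ^ n) (by rw [HahnSeries.order_zpow, h2', smul_zero]),
    HahnSeries.leadingCoeff_zpow,
    HahnSeries.coeff_zero_eq_leadingCoeff (by rw [HahnSeries.order_zpow, h1', smul_zero]),
    HahnSeries.leadingCoeff_zpow, hlc, one_zpow]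

end PrincipalUnit

/-- the higher tame symbol of `k((u))((t))` is trivial whenever one of its
entries is a principal unit, i.e. `h = 1` or `(v₂(h-1), v̄₁(h-1)) >_lex (0,0)`. -/
theorem tame_symbol_trivial_on_principal_units
    (k : Type*) [Field k]
    (h : LaurentSeries (LaurentSeries k))
    (hh : h = 1 ∨ (h ≠ 1 ∧
      (0 < v2 (h - 1) ∨ (v2 (h - 1) = 0 ∧ 0 < v1 (h - 1))))) :
    ∀ f g : LaurentSeries (LaurentSeries k), f ≠ 0 → g ≠ 0 →
      tameSymbol f g h = 1 ∧ tameSymbol f h g = 1 ∧ tameSymbol h f g = 1 := by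
  have ht := (HahnSeries.orderTop_self_sub_one_pos_iff _).1 (coeff_zero_sub_one_orderTop_pos hh)
  have h2 : v2 h = 0 := order_eq_zero_of_principal_unit hh
  have h0 : h.coeff 0 = h.leadingCoeff := HahnSeries.coeff_zero_eq_leadingCoeff h2
  have h1 : v1 h = 0 := by
    unfold v1
    rw [order_eq_zero_of_principal_unit hh]
    have hne : h.coeff 0 ≠ 0 := fun hz ↦ by simp [hz] at ht
    exact_mod_cast (HahnSeries.order_eq_orderTop_of_ne_zero hne).trans ht.1
  have hpow := coeff_coeff_zpow_eq_one h2 h1 (h0 ▸ ht.2)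
  intro f g _ _
  refine ⟨?_, ?_, ?_⟩ <;> simpa [tameSymbol, h1, h2] using hpow _
end
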